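/- Let p be a prime and let β ∈ 𝓑₊(p) satisfy β + β̄ = p. There exists a bound Q (depending only on p) such that for every prime q > Q with q ≡ β (mod p), there exists a prime r > q such that A(pqr) = p − β, where A denotes the height of the cyclotomic polynomial. -/

import Mathlib

/-- The inverse of `b` modulo `p`, normalized to lie in `[0, p-1]`
(for `p` prime and `p ∤ b` it is the unique integer in `[1, p-1]` with `b * modInv p b ≡ 1 (mod p)`). -/
def modInv (p b : ℕ) : ℕ := ((b : ZMod p)⁻¹).val

/-- The set `𝓑₊(p)` of integers `β` with `1 ≤ β ≤ (p-3)/2`, `β + β̄ ≥ p` and `β̄ ≤ 2β`. -/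
def Bplus (p : ℕ) : Finset ℕ :=
  (Finset.Icc 1 p).filter fun β =>
    2 * β + 3 ≤ p ∧ p ≤ β + modInv p β ∧ modInv p β ≤ 2 * β

/-- The height `A(n)` of the `n`-th cyclotomic polynomial: the maximum absolute value
of its coefficients. -/
noncomputable def cycHeight (n : ℕ) : ℕ :=
  (Finset.range ((Polynomial.cyclotomic n ℤ).natDegree + 1)).sup
    fun k => ((Polynomial.cyclotomic n ℤ).coeff k).natAbs

open Polynomial Finset

theorem cyclotomic_mul_prime_mul (p q : ℕ) (hp : p.Prime) (hq : q.Prime) (hpq : p ≠ q) :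
    cyclotomic (p * q) ℤ * ((X ^ p - 1) * (X ^ q - 1)) = (X ^ (p * q) - 1) * (X - 1) := by
  have : Fact p.Prime := ⟨hp⟩
  have h1 := cyclotomic_expand_eq_cyclotomic_mul (n := p) hq
    (fun h => hpq ((Nat.prime_dvd_prime_iff_eq hq hp).1 h).symm) ℤ
  have h2 := cyclotomic_prime_mul_X_sub_one ℤ p
  have h3 := congrArg (expand ℤ q) h2
  simp only [map_mul, map_sub, map_pow, expand_X, map_one, h1] at h3
  rw [← pow_mul, mul_comm q p] at h3
  rw [← h3, ← h2]
  ring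

/-- The Lam–Leung formula for `Φ_{pq}`, where `a p + b q = p q + 1`. -/
theorem cyclotomic_mul_prime_eq (p q a b a' b' : ℕ) (hp : p.Prime) (hq : q.Prime) (hpq : p ≠ q)
    (ha : a + a' = q) (hb : b + b' = p) (hab : a * p + b * q = p * q + 1) :
    cyclotomic (p * q) ℤ =
      (∑ x ∈ range a, ∑ y ∈ range b, X ^ (x * p + y * q)) -
        ∑ x ∈ range a', ∑ y ∈ range b', X ^ (1 + x * p + y * q) := by
  have e1 : (∑ x ∈ range a, ∑ y ∈ range b, X ^ (x * p + y * q) : ℤ[X]) =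
      (∑ x ∈ range a, (X ^ p) ^ x) * ∑ y ∈ range b, (X ^ q) ^ y := by
    rw [sum_mul_sum]
    refine sum_congr rfl fun x _ => sum_congr rfl fun y _ => ?_
    ring
  have e2 : (∑ x ∈ range a', ∑ y ∈ range b', X ^ (1 + x * p + y * q) : ℤ[X]) =
      X * ((∑ x ∈ range a', (X ^ p) ^ x) * ∑ y ∈ range b', (X ^ q) ^ y) := by
    rw [sum_mul_sum, mul_sum]
    refine sum_congr rfl fun x _ => ?_
    rw [mul_sum]
    refine sum_congr rfl fun y _ => ?_
    ring
  have hne : ((X ^ p - 1) * (X ^ q - 1) : ℤ[X]) ≠ 0 :=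
    mul_ne_zero (X_pow_sub_C_ne_zero hp.pos 1) (X_pow_sub_C_ne_zero hq.pos 1)
  refine mul_right_cancel₀ hne ?_
  rw [cyclotomic_mul_prime_mul p q hp hq hpq, e1, e2]
  have g1 := geom_sum_mul (X ^ p : ℤ[X]) a
  have g2 := geom_sum_mul (X ^ q : ℤ[X]) b
  have g3 := geom_sum_mul (X ^ p : ℤ[X]) a'
  have g4 := geom_sum_mul (X ^ q : ℤ[X]) b'
  have k1 : (X ^ p : ℤ[X]) ^ a * (X ^ q) ^ b = X ^ (p * q) * X := by
    rw [← pow_mul, ← pow_mul, ← pow_add, ← pow_succ, ← hab]; ring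
  have k2 : (X ^ p : ℤ[X]) ^ a * (X ^ p) ^ a' = X ^ (p * q) := by
    rw [← pow_add, ha, pow_mul]
  have k3 : (X ^ q : ℤ[X]) ^ b * (X ^ q) ^ b' = X ^ (p * q) := by
    rw [← pow_add, hb, mul_comm p q, pow_mul]
  have k4 : X * ((X ^ p : ℤ[X]) ^ a' * (X ^ q) ^ b') = X ^ (p * q) := by
    have h0 : ((X ^ p : ℤ[X]) ^ a * (X ^ q) ^ b) ≠ 0 := by
      simp
    refine mul_left_cancel₀ h0 ?_
    calc _ = X * (((X ^ p : ℤ[X]) ^ a * (X ^ p) ^ a') * ((X ^ q) ^ b * (X ^ q) ^ b')) := by ring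
      _ = _ := by rw [k2, k3, k1]; ring
  have k5 : X * (X ^ p : ℤ[X]) ^ a' = (X ^ q) ^ b := by
    have h0 : (X ^ p : ℤ[X]) ^ a ≠ 0 := by simp
    refine mul_left_cancel₀ h0 ?_
    rw [k1, mul_left_comm, k2, mul_comm]
  have k6 : X * (X ^ q : ℤ[X]) ^ b' = (X ^ p) ^ a := by
    have h0 : (X ^ q : ℤ[X]) ^ b ≠ 0 := by simp
    refine mul_left_cancel₀ h0 ?_
    rw [mul_comm _ ((X ^ p) ^ a), k1, mul_left_comm, k3, mul_comm]
  set A := ∑ x ∈ range a, (X ^ p : ℤ[X]) ^ x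
  set B := ∑ y ∈ range b, (X ^ q : ℤ[X]) ^ y
  set A' := ∑ x ∈ range a', (X ^ p : ℤ[X]) ^ x
  set B' := ∑ y ∈ range b', (X ^ q : ℤ[X]) ^ y
  calc _ = ((X ^ p : ℤ[X]) ^ a - 1) * ((X ^ q) ^ b - 1)
        - X * (((X ^ p) ^ a' - 1) * ((X ^ q) ^ b' - 1)) := by
        linear_combination -k1 + k4 - k5 - k6
    _ = _ := by rw [← g1, ← g2, ← g3, ← g4]; ring

theorem cyclotomic_mul_prime_prime_mul (p q r : ℕ) (hp : p.Prime) (hq : q.Prime) (hr : r.Prime)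
    (hpq : p ≠ q) (hpr : p ≠ r) (hqr : q ≠ r) :
    cyclotomic (p * q * r) ℤ * (1 - X ^ (p * q)) =
      expand ℤ r (cyclotomic (p * q) ℤ) * ((∑ m ∈ range p, X ^ m) * (1 - X ^ q)) := by
  have hdvd : ¬ r ∣ p * q := by
    rw [hr.dvd_mul, Nat.prime_dvd_prime_iff_eq hr hp, Nat.prime_dvd_prime_iff_eq hr hq]
    rintro (h | h)
    exacts [hpr h.symm, hqr h.symm]
  have h1 := cyclotomic_expand_eq_cyclotomic_mul hr hdvd ℤ
  have h2 := cyclotomic_mul_prime_mul p q hp hq hpq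
  have h3 := geom_sum_mul (X : ℤ[X]) p
  refine mul_right_cancel₀ (X_sub_C_ne_zero (1 : ℤ)) ?_
  rw [h1, C_1]
  linear_combination (cyclotomic (p * q * r) ℤ) * h2 -
    (cyclotomic (p * q * r) ℤ) * (cyclotomic (p * q) ℤ) * (1 - X ^ q) * h3

/-- The sum of the coefficients in degrees `k ≤ n` with `k ≡ n` modulo `d`, i.e. the
`n`-th coefficient of the quotient by `1 - X ^ d` as a power series. -/
noncomputable def residueSum (d n : ℕ) : ℤ[X] →ₗ[ℤ] ℤ :=
  ∑ k ∈ (range (n + 1)).filter (fun k => k ≡ n [MOD d]), lcoeff ℤ k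

theorem residueSum_X_pow (d n k : ℕ) :
    residueSum d n (X ^ k) = if k ≤ n ∧ k ≡ n [MOD d] then 1 else 0 := by
  simp [residueSum, LinearMap.sum_apply, coeff_X_pow]

theorem residueSum_mul_one_sub (d n : ℕ) (hd : 0 < d) (P : ℤ[X]) :
    residueSum d n (P * (1 - X ^ d)) = P.coeff n := by
  have : (residueSum d n).comp (LinearMap.mulRight ℤ (1 - X ^ d : ℤ[X])) = lcoeff ℤ n := by
    refine lhom_ext' fun k => LinearMap.ext_ring ?_
    simp only [LinearMap.comp_apply, LinearMap.mulRight_apply, lcoeff_apply,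
      monomial_one_right_eq_X_pow, mul_sub, mul_one, ← pow_add, map_sub, residueSum_X_pow,
      coeff_X_pow]
    have hk : k + d ≡ n [MOD d] ↔ k ≡ n [MOD d] := by simp [Nat.ModEq]
    simp only [hk]
    by_cases h : k ≡ n [MOD d]
    · simp only [h, and_true]
      by_cases h1 : k + d ≤ n
      · rw [if_pos (by omega), if_pos h1, if_neg (by omega)]; rfl
      · by_cases h2 : k ≤ n
        · have : n = k := by
            obtain ⟨c, hc⟩ := (Nat.modEq_iff_dvd' h2).1 h
            rcases Nat.eq_zero_or_pos c with rfl | hc'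
            · omega
            · have := Nat.le_mul_of_pos_right d hc'
              omega
          simp [this, hd.ne']
        · rw [if_neg h2, if_neg h1, if_neg (by omega)]; rfl
    · have : n ≠ k := by rintro rfl; exact h rfl
      simp [h, this]
  exact LinearMap.congr_fun this P

theorem sum_sum_ite_eq_and (A B x₀ y₀ : ℕ) (Q : ℕ → ℕ → Prop) [∀ x y, Decidable (Q x y)] :
    (∑ x ∈ range A, ∑ y ∈ range B, if Q x y ∧ x = x₀ ∧ y = y₀ then (1 : ℤ) else 0) =
      if x₀ < A ∧ y₀ < B ∧ Q x₀ y₀ then 1 else 0 := by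
  have h : ∀ x ∈ range A, (∑ y ∈ range B, if Q x y ∧ x = x₀ ∧ y = y₀ then (1 : ℤ) else 0) =
      if x = x₀ then (if y₀ < B ∧ Q x₀ y₀ then 1 else 0) else 0 := by
    intro x _
    split_ifs with h1 h2
    · subst h1
      rw [sum_eq_single y₀]
      · simp [h2.2]
      · intro y _ hy
        simp [hy]
      · intro hy
        exact absurd (mem_range.2 h2.1) hy
    · subst h1
      refine sum_eq_zero fun y hy => if_neg ?_
      rintro ⟨h3, -, rfl⟩
      exact h2 ⟨mem_range.1 hy, h3⟩
    · exact sum_eq_zero fun y _ => if_neg fun h3 => h1 h3.2.1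
  rw [sum_congr rfl h, sum_ite_eq']
  simp only [mem_range]
  split_ifs <;> tauto

/-- The coefficient of `Φ_{pq}` in the degree congruent to `x p + y q` modulo `p q`, if this
degree is at most `N`, and `0` otherwise; here `a p + b q = p q + 1`. -/
def truncCoeff (p q a b N x y : ℕ) : ℤ :=
  (if x < a ∧ y < b ∧ x * p + y * q ≤ N then 1 else 0) -
    if a ≤ x ∧ b ≤ y ∧ x * p + y * q ≤ N + p * q then 1 else 0

theorem mul_add_le_iff_le_div (d r n k m : ℕ) (hr : d < r) (hm : m < d)
    (h : r * k + m ≡ n [MOD d]) : r * k + m ≤ n ↔ k ≤ n / r := by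
  have hr0 : 0 < r := by omega
  rw [Nat.le_div_iff_mul_le hr0, mul_comm k r]
  refine ⟨fun h' => by omega, fun h' => ?_⟩
  by_contra hlt
  have h1 : m ≡ n - r * k [MOD d] := by
    refine Nat.ModEq.add_left_cancel' (r * k) ?_
    rwa [Nat.add_sub_cancel' h']
  rw [Nat.ModEq, Nat.mod_eq_of_lt hm, Nat.mod_eq_of_lt (by omega)] at h1
  omega

theorem modEq_mul_iff_eq_val (p q r e n x y m : ℕ) (hp : p.Prime) (hq : q.Prime) (hpq : p ≠ q)
    (hx : x < q) (hy : y < p) (hrq : (r * q : ZMod p) = 1) (hrp : (r * p * e : ZMod q) = -1) :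
    r * (x * p + y * q) + m ≡ n [MOD p * q] ↔
      x = (e * (m - n) : ZMod q).val ∧ y = (n - m : ZMod p).val := by
  have : Fact p.Prime := ⟨hp⟩
  have : Fact q.Prime := ⟨hq⟩
  rw [← Nat.modEq_and_modEq_iff_modEq_mul ((Nat.coprime_primes hp hq).2 hpq), and_comm]
  refine and_congr ?_ ?_
  · rw [← ZMod.natCast_eq_natCast_iff]
    have : x = (e * (m - n) : ZMod q).val ↔ (x : ZMod q) = e * (m - n) := by
      constructor
      · intro h; rw [h, ZMod.natCast_zmod_val]
      · intro h; rw [← h, ZMod.val_cast_of_lt hx]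
    rw [this]
    push_cast
    rw [ZMod.natCast_self]
    constructor
    · intro h
      linear_combination x * hrp - e * h
    · intro h
      linear_combination r * p * h + (m - n) * hrp
  · rw [← ZMod.natCast_eq_natCast_iff]
    have : y = (n - m : ZMod p).val ↔ (y : ZMod p) = n - m := by
      constructor
      · intro h; rw [h, ZMod.natCast_zmod_val]
      · intro h; rw [← h, ZMod.val_cast_of_lt hy]
    rw [this]
    push_cast
    rw [ZMod.natCast_self]
    constructor
    · intro h
      linear_combination -y * hrq + h
    · intro h
      linear_combination h + y * hrq

theorem residueSum_expand_mul_X_pow (p q r a b e n m : ℕ) (hp : p.Prime) (hq : q.Prime)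
    (hpq : p ≠ q) (haq : a ≤ q) (hbp : b ≤ p) (hab : a * p + b * q = p * q + 1) (hr : p * q < r)
    (hrq : (r * q : ZMod p) = 1) (hrp : (r * p * e : ZMod q) = -1) (hm : m < p * q) :
    residueSum (p * q) n (expand ℤ r (cyclotomic (p * q) ℤ) * X ^ m) =
      truncCoeff p q a b (n / r) (e * (m - n) : ZMod q).val (n - m : ZMod p).val := by
  have : Fact p.Prime := ⟨hp⟩
  have : Fact q.Prime := ⟨hq⟩
  obtain ⟨a', ha⟩ := Nat.exists_eq_add_of_le haq
  obtain ⟨b', hb⟩ := Nat.exists_eq_add_of_le hbp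
  rw [cyclotomic_mul_prime_eq p q a b a' b' hp hq hpq ha.symm hb.symm hab]
  simp only [map_sub, map_sum, map_pow, expand_X, sub_mul, sum_mul, ← pow_mul, ← pow_add,
    residueSum_X_pow]
  have hX := ZMod.val_lt (e * (m - n) : ZMod q)
  have hY := ZMod.val_lt (n - m : ZMod p)
  have key := fun x y hx hy => modEq_mul_iff_eq_val p q r e n x y m hp hq hpq hx hy hrq hrp
  set x₀ := (e * (m - n) : ZMod q).val
  set y₀ := (n - m : ZMod p).val
  unfold truncCoeff
  congr 1
  · rw [← sum_sum_ite_eq_and a b x₀ y₀ (fun x y => x * p + y * q ≤ n / r)]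
    refine sum_congr rfl fun x hx => sum_congr rfl fun y hy => if_congr ?_ rfl rfl
    rw [mem_range] at hx hy
    rw [← key x y (by omega) (by omega)]
    refine and_congr_left fun h => mul_add_le_iff_le_div _ _ _ _ _ hr hm h
  · have hpos : ∀ x y, (a + x) * p + (b + y) * q = p * q + (1 + x * p + y * q) := by
      intro x y
      linear_combination hab
    have hle : (a ≤ x₀ ∧ b ≤ y₀ ∧ x₀ * p + y₀ * q ≤ n / r + p * q) ↔
        (x₀ - a < a' ∧ y₀ - b < b' ∧
          ((a ≤ x₀ ∧ b ≤ y₀) ∧ 1 + (x₀ - a) * p + (y₀ - b) * q ≤ n / r)) := by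
      constructor
      · rintro ⟨h1, h2, h3⟩
        have := hpos (x₀ - a) (y₀ - b)
        rw [Nat.add_sub_cancel' h1, Nat.add_sub_cancel' h2] at this
        omega
      · rintro ⟨-, -, ⟨h1, h2⟩, h3⟩
        have := hpos (x₀ - a) (y₀ - b)
        rw [Nat.add_sub_cancel' h1, Nat.add_sub_cancel' h2] at this
        omega
    rw [if_congr hle rfl rfl, ← sum_sum_ite_eq_and a' b' (x₀ - a) (y₀ - b)
      (fun x y => (a ≤ x₀ ∧ b ≤ y₀) ∧ 1 + x * p + y * q ≤ n / r)]
    refine sum_congr rfl fun x hx => sum_congr rfl fun y hy => if_congr ?_ rfl rfl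
    rw [mem_range] at hx hy
    have h1 : r * (1 + x * p + y * q) + m ≡ n [MOD p * q] ↔
        r * ((a + x) * p + (b + y) * q) + m ≡ n [MOD p * q] := by
      rw [hpos, show r * (p * q + (1 + x * p + y * q)) + m =
        p * q * r + (r * (1 + x * p + y * q) + m) by ring]
      simp only [Nat.ModEq, Nat.mul_add_mod]
    have h2 := key (a + x) (b + y) (by omega) (by omega)
    constructor
    · rintro ⟨h3, h4⟩
      have h5 := h2.1 (h1.1 h4)
      have := (mul_add_le_iff_le_div _ _ _ _ _ hr hm h4).1 h3
      omega
    · rintro ⟨⟨h3, h4⟩, h5, h6⟩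
      have h7 := h1.2 (h2.2 (by omega))
      exact ⟨(mul_add_le_iff_le_div _ _ _ _ _ hr hm h7).2 h4, h7⟩

/-- Kaplan's formula for the coefficients of `Φ_{pqr}` with `r > p q`, in coordinates. -/
theorem coeff_cyclotomic_mul_mul (p q r a b e n : ℕ) (hp : p.Prime) (hq : q.Prime)
    (hr : r.Prime) (hpq : p < q) (haq : a ≤ q) (hbp : b ≤ p) (hab : a * p + b * q = p * q + 1)
    (hpqr : p * q < r) (hrq : (r * q : ZMod p) = 1) (hrp : (r * p * e : ZMod q) = -1) :
    (cyclotomic (p * q * r) ℤ).coeff n = ∑ m ∈ range p,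
      (truncCoeff p q a b (n / r) (e * (m - n) : ZMod q).val (n - m : ZMod p).val -
        truncCoeff p q a b (n / r) (e * (m - n) : ZMod q).val (n - m - q : ZMod p).val) := by
  have hp2 := hp.two_le
  have h2q : 2 * q ≤ p * q := Nat.mul_le_mul_right q hp2
  rw [← residueSum_mul_one_sub (p * q) n (Nat.mul_pos hp.pos hq.pos),
    cyclotomic_mul_prime_prime_mul p q r hp hq hr hpq.ne (by omega) (by omega),
    mul_sub, mul_one, sum_mul, mul_sub, mul_sum, mul_sum, ← sum_sub_distrib, map_sum]
  refine sum_congr rfl fun m hm => ?_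
  rw [mem_range] at hm
  rw [map_sub, ← pow_add,
    residueSum_expand_mul_X_pow p q r a b e n m hp hq hpq.ne haq hbp hab hpqr hrq hrp (by omega),
    residueSum_expand_mul_X_pow p q r a b e n (m + q) hp hq hpq.ne haq hbp hab hpqr hrq hrp
      (by omega)]
  push_cast
  rw [ZMod.natCast_self, add_zero, sub_sub]

theorem truncCoeff_sub_mem_of_lt (p q a β N x y : ℕ) (hβ : 2 * β ≤ p) (hy : y < β) :
    0 ≤ truncCoeff p q a (p - β) N x y - truncCoeff p q a (p - β) N x (y + p - β) ∧
      truncCoeff p q a (p - β) N x y - truncCoeff p q a (p - β) N x (y + p - β) ≤ 1 := by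
  unfold truncCoeff
  split_ifs <;> omega

theorem truncCoeff_sub_mem_of_le (p q a β N x y : ℕ) (hβ : β ≤ y) (hy : y < p) :
    -1 ≤ truncCoeff p q a (p - β) N x y - truncCoeff p q a (p - β) N x (y - β) ∧
      truncCoeff p q a (p - β) N x y - truncCoeff p q a (p - β) N x (y - β) ≤ 0 := by
  have := Nat.mul_le_mul_right q (Nat.sub_le y β)
  unfold truncCoeff
  split_ifs <;> omega

theorem ZMod.val_sub_natCast_of_le (p β : ℕ) (z : ZMod p) [NeZero p] (h : β ≤ z.val) :
    (z - β).val = z.val - β := by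
  have h1 : ((z.val - β : ℕ) : ZMod p) = z - β := by
    rw [Nat.cast_sub h, ZMod.natCast_zmod_val]
  rw [← h1, ZMod.val_cast_of_lt]
  have := ZMod.val_lt z
  omega

theorem ZMod.val_sub_natCast_of_lt (p β : ℕ) (z : ZMod p) [NeZero p] (h : z.val < β)
    (hβ : β ≤ p) : (z - β).val = z.val + p - β := by
  have h1 : ((z.val + p - β : ℕ) : ZMod p) = z - β := by
    rw [Nat.cast_sub (by omega), Nat.cast_add, ZMod.natCast_zmod_val, ZMod.natCast_self, add_zero]
  rw [← h1, ZMod.val_cast_of_lt]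
  omega

theorem sum_range_val_sub {M : Type*} [AddCommMonoid M] (p : ℕ) [NeZero p] (z : ZMod p)
    (f : ℕ → M) : ∑ m ∈ range p, f (z - m).val = ∑ y ∈ range p, f y := by
  refine sum_bij (fun m _ => (z - m).val) (fun m _ => mem_range.2 (ZMod.val_lt _)) ?_ ?_
    fun _ _ => rfl
  · intro m hm m' hm' h
    have h1 := sub_right_injective (ZMod.val_injective p h)
    have h2 := congrArg ZMod.val h1
    rwa [ZMod.val_cast_of_lt (mem_range.1 hm), ZMod.val_cast_of_lt (mem_range.1 hm')] at h2
  · intro y hy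
    refine ⟨(z - y).val, mem_range.2 (ZMod.val_lt _), ?_⟩
    rw [ZMod.natCast_zmod_val, sub_sub_cancel, ZMod.val_cast_of_lt (mem_range.1 hy)]

theorem sum_range_ite_lt (p β : ℕ) (hβ : β ≤ p) (u v : ℤ) :
    ∑ y ∈ range p, (if y < β then u else v) = β * u + (p - β) * v := by
  obtain ⟨c, rfl⟩ := Nat.exists_eq_add_of_le hβ
  rw [sum_range_add, sum_congr rfl fun y hy => if_pos (mem_range.1 hy),
    sum_congr rfl fun y _ => if_neg (by omega)]
  simp

theorem truncCoeff_eq_zero_of_low (p q a β e j : ℕ) (hjp : j < p)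
    (he' : (β - 1) * q < (2 * β - 1) * (e * p)) (heq : e * p ≤ q) (hj : j < 2 * β)
    (hlow : j * e < a) :
    truncCoeff p q a (p - β) ((p - β - 1) * q) (j * e) (p - 1 - j) = 0 := by
  unfold truncCoeff
  rw [if_neg, if_neg (by omega), sub_zero]
  rintro ⟨-, h1, h2⟩
  obtain ⟨i, rfl⟩ : ∃ i, j = β + i := Nat.exists_eq_add_of_le (by omega)
  obtain ⟨s, rfl⟩ : ∃ s, β = i + 1 + s := Nat.exists_eq_add_of_le (by omega)
  obtain ⟨y, hy⟩ : ∃ y, p = y + (1 + (i + 1 + s + i)) := Nat.exists_eq_add_of_le' (by omega)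
  rw [show p - 1 - (i + 1 + s + i) = y by omega,
    show p - (i + 1 + s) - 1 = y + i by omega] at h2
  rw [show i + 1 + s - 1 = i + s by omega,
    show 2 * (i + 1 + s) - 1 = i + 1 + s + i + s by omega] at he'
  have h3 := Nat.mul_le_mul_left s heq
  rw [mul_assoc] at h2
  linarith

theorem mul_lt_of_low (p q a β e j : ℕ) (ha : a * p = q * β + 1) (he : 2 * (e * p) ≤ q)
    (hj : j < 2 * β) : j * e < a := by
  refine Nat.lt_of_mul_lt_mul_right (a := p) ?_
  rw [ha, mul_assoc]
  have h1 := Nat.mul_le_mul_left j he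
  have h2 := Nat.mul_le_mul_right q hj.le
  linarith

theorem truncCoeff_sub_eq_neg_one (p q a β e j : ℕ) (ha : a * p = q * β + 1)
    (he : 2 * (e * p) ≤ q) (he' : (β - 1) * q < (2 * β - 1) * (e * p))
    (hj : j < 2 * β) (hjβ : j < p - β) :
    truncCoeff p q a (p - β) ((p - β - 1) * q) (j * e) (p - 1 - j) -
      truncCoeff p q a (p - β) ((p - β - 1) * q) (j * e) (p - 1 - j - β) = -1 := by
  have hlow := mul_lt_of_low p q a β e j ha he hj
  rw [truncCoeff_eq_zero_of_low p q a β e j (by omega) he' (by omega) hj hlow]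
  unfold truncCoeff
  rw [if_pos, if_neg (by omega)]
  · norm_num
  · refine ⟨hlow, by omega, ?_⟩
    rw [show p - β - 1 = p - 1 - j - β + j by omega, add_mul, add_comm, mul_assoc]
    exact Nat.add_le_add_left (Nat.mul_le_mul_left j (by omega)) _

theorem truncCoeff_sub_eq_zero_of_low (p q a β e j : ℕ) (ha : a * p = q * β + 1)
    (he : 2 * (e * p) ≤ q) (he' : (β - 1) * q < (2 * β - 1) * (e * p))
    (hj : j < 2 * β) (hjp : j < p) :
    truncCoeff p q a (p - β) ((p - β - 1) * q) (j * e) (p - 1 - j) -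
      truncCoeff p q a (p - β) ((p - β - 1) * q) (j * e) (p - 1 - j + p - β) = 0 := by
  have hlow := mul_lt_of_low p q a β e j ha he hj
  rw [truncCoeff_eq_zero_of_low p q a β e j hjp he' (by omega) hj hlow]
  unfold truncCoeff
  rw [if_neg (by omega), if_neg (by omega)]
  norm_num

theorem truncCoeff_sub_eq_zero_of_high (p q a β e i : ℕ) (ha : a * p = q * β + 1)
    (hβp : 2 * β < p) (hq : 2 ≤ q) (he : 2 * (e * p) < q) (hi : 1 ≤ i) (hiβ : i ≤ β) :
    truncCoeff p q a (p - β) ((p - β - 1) * q) (q - i * e) (i - 1) -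
      truncCoeff p q a (p - β) ((p - β - 1) * q) (q - i * e) (i - 1 + p - β) = 0 := by
  have h1 := Nat.mul_le_mul_left i he.le
  have h2 := Nat.mul_le_mul_right q hiβ
  have h3 := Nat.mul_le_mul_right q (show 2 * β + 1 ≤ p by omega)
  have h4 : (q - i * e) * p + i * (e * p) = p * q := by
    have : i * e ≤ q := by
      refine Nat.le_of_mul_le_mul_right (c := p) ?_ (by omega)
      rw [mul_assoc]
      have := Nat.zero_le (i * (e * p))
      nlinarith
    rw [← mul_assoc, ← add_mul, Nat.sub_add_cancel this, mul_comm]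
  have hhigh : a ≤ q - i * e := by
    refine Nat.le_of_mul_le_mul_right (c := p) ?_ (by omega)
    rw [ha]
    nlinarith
  unfold truncCoeff
  rw [if_neg (by omega), if_neg (by omega), if_neg (by omega), if_neg]
  · norm_num
  · rintro ⟨-, -, h5⟩
    rw [show i - 1 + p - β = p - β - 1 + i by omega, add_mul] at h5
    have h6 := Nat.mul_lt_mul_of_pos_left (show e * p < q by omega) hi
    omega

theorem mul_add_sub_mul_self_eq (p q β : ℕ) (a : ℕ) (ha : a * p = q * β + 1) (hβ : β ≤ p) :
    a * p + (p - β) * q = p * q + 1 := by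
  obtain ⟨c, rfl⟩ := Nat.exists_eq_add_of_le hβ
  rw [Nat.add_sub_cancel_left, ha]
  ring

/-- The data of a ternary `n = p q r` for which the height of `Φ_n` is shown to be `p - β`. -/
structure TernaryData (p q r a β e : ℕ) : Prop where
  prime_p : p.Prime
  prime_q : q.Prime
  prime_r : r.Prime
  two_mul_lt : 2 * β < p
  le_three_mul : p ≤ 3 * β
  q_eq : (q : ZMod p) = β
  p_lt_q : p < q
  mul_lt_r : p * q < r
  mul_p_eq : a * p = q * β + 1
  r_mul_q : (r * q : ZMod p) = 1
  r_mul_p_mul_e : (r * p * e : ZMod q) = -1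
  two_mul_e_lt : 2 * (e * p) < q
  lt_mul_e : (β - 1) * q < (2 * β - 1) * (e * p)

namespace TernaryData

variable {p q r a β e : ℕ}

theorem coeff_eq (h : TernaryData p q r a β e) (n : ℕ) :
    (cyclotomic (p * q * r) ℤ).coeff n = ∑ m ∈ range p,
      (truncCoeff p q a (p - β) (n / r) (e * (m - n) : ZMod q).val (n - m : ZMod p).val -
        truncCoeff p q a (p - β) (n / r) (e * (m - n) : ZMod q).val (n - m - β : ZMod p).val) := by
  have h1 := h.two_mul_lt
  have haq : a ≤ q := by
    refine Nat.le_of_mul_le_mul_right (c := p) ?_ h.prime_p.pos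
    rw [h.mul_p_eq]
    have := Nat.mul_lt_mul_of_pos_left (show β < p by omega) h.prime_q.pos
    omega
  rw [← h.q_eq]
  exact coeff_cyclotomic_mul_mul p q r a (p - β) e n h.prime_p h.prime_q h.prime_r h.p_lt_q haq
    (Nat.sub_le _ _) (mul_add_sub_mul_self_eq p q β a h.mul_p_eq (by omega)) h.mul_lt_r h.r_mul_q
    h.r_mul_p_mul_e

theorem sum_ite_val_sub (h : TernaryData p q r a β e) (n : ℕ) (u v : ℤ) :
    ∑ m ∈ range p, (if (n - m : ZMod p).val < β then u else v) = β * u + (p - β) * v := by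
  have : NeZero p := ⟨h.prime_p.ne_zero⟩
  have h1 := h.two_mul_lt
  rw [← sum_range_ite_lt p β (by omega)]
  exact sum_range_val_sub p (n : ZMod p) fun y => if y < β then u else v

theorem coeff_mem (h : TernaryData p q r a β e) (n : ℕ) :
    -((p : ℤ) - β) ≤ (cyclotomic (p * q * r) ℤ).coeff n ∧
      (cyclotomic (p * q * r) ℤ).coeff n ≤ β := by
  have : NeZero p := ⟨h.prime_p.ne_zero⟩
  have hβ := h.two_mul_lt
  have key : ∀ m : ℕ, ∀ x : ℕ,
      (if (n - m : ZMod p).val < β then (0 : ℤ) else -1) ≤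
        truncCoeff p q a (p - β) (n / r) x (n - m : ZMod p).val -
          truncCoeff p q a (p - β) (n / r) x (n - m - β : ZMod p).val ∧
      truncCoeff p q a (p - β) (n / r) x (n - m : ZMod p).val -
          truncCoeff p q a (p - β) (n / r) x (n - m - β : ZMod p).val ≤
        (if (n - m : ZMod p).val < β then 1 else 0) := by
    intro m x
    split_ifs with hm
    · rw [ZMod.val_sub_natCast_of_lt p β _ hm (by omega)]
      exact truncCoeff_sub_mem_of_lt p q a β _ x _ hβ.le hm
    · rw [ZMod.val_sub_natCast_of_le p β _ (not_lt.1 hm)]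
      exact truncCoeff_sub_mem_of_le p q a β _ x _ (not_lt.1 hm) (ZMod.val_lt _)
  rw [h.coeff_eq n]
  constructor
  · refine le_trans (le_of_eq ?_) (sum_le_sum fun m _ => (key m _).1)
    rw [h.sum_ite_val_sub]
    ring
  · refine (sum_le_sum fun m _ => (key m _).2).trans (le_of_eq ?_)
    rw [h.sum_ite_val_sub]
    ring

theorem coeff_eq_of_natCast_eq (h : TernaryData p q r a β e) (n : ℕ)
    (hN : n / r = (p - β - 1) * q) (hnp : (n : ZMod p) = (p - 2 * β - 1 : ℕ))
    (hnq : (n : ZMod q) = (p - 2 * β : ℕ)) :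
    (cyclotomic (p * q * r) ℤ).coeff n = -((p : ℤ) - β) := by
  have : NeZero p := ⟨h.prime_p.ne_zero⟩
  have : NeZero q := ⟨h.prime_q.ne_zero⟩
  have hβ := h.two_mul_lt
  have hβ' := h.le_three_mul
  have hq2 := h.prime_q.two_le
  have hval : ∀ (s k : ℕ) (z : ZMod s), k < s → (k : ZMod s) = z → z.val = k := by
    rintro s k z hk rfl
    exact ZMod.val_cast_of_lt hk
  have key : ∀ m ∈ range p,
      truncCoeff p q a (p - β) (n / r) (e * (m - n) : ZMod q).val (n - m : ZMod p).val -
        truncCoeff p q a (p - β) (n / r) (e * (m - n) : ZMod q).val (n - m - β : ZMod p).val =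
      if (n - m : ZMod p).val < β then 0 else -1 := by
    intro m hm
    rw [mem_range] at hm
    rw [hN]
    by_cases hmh : m < p - 2 * β
    · have hY : (n - m : ZMod p).val = p - 2 * β - m - 1 := by
        refine hval _ _ _ (by omega) ?_
        rw [hnp, ← Nat.cast_sub (by omega)]
        congr 1
        omega
      have hpos : 0 < (p - 2 * β - m) * e := by
        have := h.lt_mul_e
        refine Nat.mul_pos (by omega) (Nat.pos_of_ne_zero ?_)
        rintro rfl
        omega
      have hle : (p - 2 * β - m) * e ≤ q := by
        have h1 := h.two_mul_e_lt
        have h2 := Nat.mul_le_mul_right e (show p - 2 * β - m ≤ p by omega)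
        rw [mul_comm p e] at h2
        omega
      have hX : (e * (m - n) : ZMod q).val = q - (p - 2 * β - m) * e := by
        refine hval _ _ _ (by omega) ?_
        rw [hnq, Nat.cast_sub hle, ZMod.natCast_self, Nat.cast_mul, Nat.cast_sub hmh.le]
        ring
      have hlt : (n - m : ZMod p).val < β := by omega
      rw [ZMod.val_sub_natCast_of_lt p β _ hlt (by omega), hX, if_pos hlt, hY]
      exact truncCoeff_sub_eq_zero_of_high p q a β e _ h.mul_p_eq hβ hq2 h.two_mul_e_lt (by omega)
        (by omega)
    · obtain ⟨j, rfl⟩ := Nat.exists_eq_add_of_le (not_lt.1 hmh)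
      have hY : (n - (p - 2 * β + j : ℕ) : ZMod p).val = p - 1 - j := by
        refine hval _ _ _ (by omega) ?_
        rw [hnp, Nat.cast_sub (show j ≤ p - 1 by omega), Nat.cast_sub h.prime_p.one_le,
          Nat.cast_sub (show 1 ≤ p - 2 * β by omega), ZMod.natCast_self, Nat.cast_add]
        ring
      have hX : (e * ((p - 2 * β + j : ℕ) - n) : ZMod q).val = j * e := by
        have h1 := h.two_mul_e_lt
        have h2 := Nat.mul_le_mul_right e (show j ≤ p by omega)
        rw [mul_comm p e] at h2
        refine hval _ _ _ (by omega) ?_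
        rw [hnq]
        push_cast
        ring
      rw [hX]
      split_ifs with hlt
      · rw [ZMod.val_sub_natCast_of_lt p β _ hlt (by omega), hY]
        exact truncCoeff_sub_eq_zero_of_low p q a β e j h.mul_p_eq h.two_mul_e_lt.le h.lt_mul_e
          (by omega) (by omega)
      · rw [ZMod.val_sub_natCast_of_le p β _ (not_lt.1 hlt), hY]
        exact truncCoeff_sub_eq_neg_one p q a β e j h.mul_p_eq h.two_mul_e_lt.le h.lt_mul_e
          (by omega) (by omega)
  rw [h.coeff_eq n, sum_congr rfl key, h.sum_ite_val_sub]
  ring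

theorem exists_coeff_eq (h : TernaryData p q r a β e) :
    ∃ n, (cyclotomic (p * q * r) ℤ).coeff n = -((p : ℤ) - β) := by
  have hcop : p.Coprime q := (Nat.coprime_primes h.prime_p h.prime_q).2 h.p_lt_q.ne
  have hpos : 0 < p * q := Nat.mul_pos h.prime_p.pos h.prime_q.pos
  have : NeZero (p * q) := ⟨hpos.ne'⟩
  have hr := h.mul_lt_r
  obtain ⟨c, hcp, hcq⟩ := Nat.chineseRemainder hcop (p - 2 * β - 1) (p - 2 * β)
  set N := (p - β - 1) * q
  set d := (c - (r * N : ℕ) : ZMod (p * q)).val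
  have hd : d < p * q := ZMod.val_lt _
  have hmod : r * N + d ≡ c [MOD p * q] := by
    rw [← ZMod.natCast_eq_natCast_iff, Nat.cast_add, ZMod.natCast_zmod_val, add_sub_cancel]
  refine ⟨r * N + d, h.coeff_eq_of_natCast_eq _ ?_ ?_ ?_⟩
  · rw [Nat.mul_add_div (by omega), Nat.div_eq_of_lt (by omega), add_zero]
  · exact (ZMod.natCast_eq_natCast_iff _ _ _).2 ((hmod.of_mul_right q).trans hcp)
  · exact (ZMod.natCast_eq_natCast_iff _ _ _).2 ((hmod.of_mul_left p).trans hcq)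

theorem cycHeight_eq (h : TernaryData p q r a β e) : cycHeight (p * q * r) = p - β := by
  have hβ := h.two_mul_lt
  refine le_antisymm (Finset.sup_le fun k _ => ?_) ?_
  · have := h.coeff_mem k
    omega
  · obtain ⟨n, hn⟩ := h.exists_coeff_eq
    have hmem : n ∈ range ((cyclotomic (p * q * r) ℤ).natDegree + 1) := by
      rw [mem_range, Nat.lt_succ_iff]
      refine le_natDegree_of_ne_zero ?_
      omega
    have h1 := Finset.le_sup (f := fun k => ((cyclotomic (p * q * r) ℤ).coeff k).natAbs) hmem
    refine le_trans ?_ h1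
    simp only [hn]
    omega

end TernaryData

theorem exists_prime_gt_natCast_eq_and_natCast_eq (p q : ℕ) (hp : p.Prime) (hq : q.Prime)
    (hpq : p ≠ q) (u : ZMod p) (v : ZMod q) (hu : u ≠ 0) (hv : v ≠ 0) (M : ℕ) :
    ∃ r, M < r ∧ r.Prime ∧ (r : ZMod p) = u ∧ (r : ZMod q) = v := by
  have : Fact p.Prime := ⟨hp⟩
  have : Fact q.Prime := ⟨hq⟩
  obtain ⟨c, hcp, hcq⟩ :=
    Nat.chineseRemainder ((Nat.coprime_primes hp hq).2 hpq) u.val v.val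
  rw [← ZMod.natCast_eq_natCast_iff, ZMod.natCast_zmod_val] at hcp hcq
  have hcop : c.Coprime (p * q) := by
    refine Nat.Coprime.mul_right ?_ ?_
    · rw [Nat.coprime_comm, hp.coprime_iff_not_dvd, ← ZMod.natCast_eq_zero_iff, hcp]
      exact hu
    · rw [Nat.coprime_comm, hq.coprime_iff_not_dvd, ← ZMod.natCast_eq_zero_iff, hcq]
      exact hv
  obtain ⟨r, hr, hrp, hrc⟩ := Nat.forall_exists_prime_gt_and_modEq M
    (Nat.mul_pos hp.pos hq.pos).ne' hcop
  refine ⟨r, hr, hrp, ?_, ?_⟩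
  · rw [← hcp]
    exact (ZMod.natCast_eq_natCast_iff _ _ _).2 (hrc.of_mul_right q)
  · rw [← hcq]
    exact (ZMod.natCast_eq_natCast_iff _ _ _).2 (hrc.of_mul_left p)

theorem stmt_3 (p : ℕ) (hp : p.Prime) (β : ℕ) (hβ : β ∈ Bplus p)
    (hsum : β + modInv p β = p) :
    ∃ Q : ℕ, ∀ q : ℕ, q.Prime → Q < q → q ≡ β [MOD p] →
      ∃ r : ℕ, r.Prime ∧ q < r ∧ cycHeight (p * q * r) = p - β := by
  have : Fact p.Prime := ⟨hp⟩
  simp only [Bplus, mem_filter, mem_Icc] at hβ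
  obtain ⟨⟨hβ1, -⟩, hβ2, -, hβ3⟩ := hβ
  have hβ0 : (β : ZMod p) ≠ 0 := by
    rw [Ne, ZMod.natCast_eq_zero_iff]
    exact Nat.not_dvd_of_pos_of_lt hβ1 (by omega)
  have hsq : (β * β + 1 : ZMod p) = 0 := by
    have h1 := congrArg (Nat.cast : ℕ → ZMod p) hsum
    rw [Nat.cast_add, modInv, ZMod.natCast_zmod_val, ZMod.natCast_self] at h1
    have h2 := mul_inv_cancel₀ hβ0
    linear_combination β * h1 - h2
  refine ⟨4 * p * p, fun q hq hQ hqβ => ?_⟩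
  have : Fact q.Prime := ⟨hq⟩
  have hqc : (q : ZMod p) = β := (ZMod.natCast_eq_natCast_iff _ _ _).2 hqβ
  have hpq : p < q := by nlinarith [hp.two_le]
  obtain ⟨a, ha⟩ : p ∣ q * β + 1 := by
    rw [← ZMod.natCast_eq_zero_iff]
    push_cast
    rw [hqc, hsq]
  have hp0 := hp.pos
  have hdm := Nat.div_add_mod q (2 * p)
  have hml := Nat.mod_lt q (show 0 < 2 * p by omega)
  set e := q / (2 * p)
  have hep : 2 * p * e = 2 * (e * p) := by ring
  have hele : 2 * (e * p) ≤ q := by omega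
  have helt : 2 * (e * p) < q := by
    refine lt_of_le_of_ne hele fun h => ?_
    have h2 : 2 ∣ q := ⟨_, h.symm⟩
    have := (Nat.prime_dvd_prime_iff_eq Nat.prime_two hq).1 h2
    have := hp.two_le
    omega
  have hlt : (β - 1) * q < (2 * β - 1) * (e * p) := by
    obtain ⟨s, rfl⟩ := Nat.exists_eq_add_of_le hβ1
    rw [show 1 + s - 1 = s by omega, show 2 * (1 + s) - 1 = 2 * s + 1 by omega]
    have h1 : q < 2 * (e * p) + 2 * p := by omega
    nlinarith
  have he0 : 0 < e := by
    refine Nat.pos_of_ne_zero fun h => ?_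
    rw [h] at hlt
    omega
  have heq : e < q := by nlinarith
  have hez : (e : ZMod q) ≠ 0 := by
    rw [Ne, ZMod.natCast_eq_zero_iff]
    exact Nat.not_dvd_of_pos_of_lt he0 heq
  have hpz : (p : ZMod q) ≠ 0 := by
    rw [Ne, ZMod.natCast_eq_zero_iff]
    exact Nat.not_dvd_of_pos_of_lt hp0 hpq
  obtain ⟨r, hr, hrp, hr1, hr2⟩ := exists_prime_gt_natCast_eq_and_natCast_eq p q hp hq hpq.ne
    (q : ZMod p)⁻¹ (-(p * e : ZMod q)⁻¹) (inv_ne_zero (hqc ▸ hβ0))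
    (neg_ne_zero.2 (inv_ne_zero (mul_ne_zero hpz hez))) (p * q)
  have hqr : q ≤ p * q := Nat.le_mul_of_pos_left q hp0
  have hdata : TernaryData p q r a β e :=
    { prime_p := hp
      prime_q := hq
      prime_r := hrp
      two_mul_lt := by omega
      le_three_mul := by omega
      q_eq := hqc
      p_lt_q := hpq
      mul_lt_r := hr
      mul_p_eq := by rw [mul_comm, ha]
      r_mul_q := by rw [hr1, inv_mul_cancel₀ (hqc ▸ hβ0)]
      r_mul_p_mul_e := by
        rw [hr2, mul_assoc, neg_mul, inv_mul_cancel₀ (mul_ne_zero hpz hez)]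
      two_mul_e_lt := helt
      lt_mul_e := hlt }
  exact ⟨r, hrp, by omega, hdata.cycHeight_eq⟩
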